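/- arXiv:math/0612008 — 2 statements merged into one kernel-verified Lean document; each statement's English description precedes it below -/
import Mathlib

section
/- Every nonempty set S of antitone functions ℕ → ℕ has a least element with respect to the lexicographic order: there exists s₀ ∈ S such that s₀ ≤_lex s for every s ∈ S. (Core of Corollary 1.2.1.3: the set of non-increasing sequences in ∏_{e∈ℕ} ℤ≥0, with the lexicographic order, is well-ordered.) -/
/-- The strict lexicographic order on sequences `ℕ → ℕ`:
`s <_lex t` iff there is `e` with `s e < t e` and `s i = t i` for all `i < e`. -/
def lexLT (s t : ℕ → ℕ) : Prop := ∃ e : ℕ, s e < t e ∧ ∀ i < e, s i = t i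

/-- The lexicographic order on sequences `ℕ → ℕ`. -/
def lexLE (s t : ℕ → ℕ) : Prop := s = t ∨ lexLT s t

/-- The elements of `S` whose first `n` entries are lexicographically least. -/
def prefixLeast (S : Set (ℕ → ℕ)) (n : ℕ) : Set (ℕ → ℕ) :=
  {s ∈ S | ∀ t ∈ S, ∀ e < n, (∀ i < e, t i = s i) → s e ≤ t e}

theorem prefixLeast_antitone (S : Set (ℕ → ℕ)) : Antitone (prefixLeast S) :=
  fun _ _ hmn _ hs => ⟨hs.1, fun t ht e he => hs.2 t ht e (he.trans_le hmn)⟩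

theorem eq_of_mem_prefixLeast {S : Set (ℕ → ℕ)} {n : ℕ} {s t : ℕ → ℕ}
    (hs : s ∈ prefixLeast S n) (ht : t ∈ prefixLeast S n) : ∀ i < n, s i = t i := by
  intro i
  induction i using Nat.strong_induction_on with
  | _ i ih =>
    intro hi
    have h : ∀ j < i, s j = t j := fun j hj => ih j hj (hj.trans hi)
    exact le_antisymm (hs.2 t ht.1 i hi fun j hj => (h j hj).symm) (ht.2 s hs.1 i hi h)

theorem mem_prefixLeast_succ {S : Set (ℕ → ℕ)} {n : ℕ} {s : ℕ → ℕ}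
    (hs : s ∈ prefixLeast S n) (hmin : ∀ t ∈ prefixLeast S n, s n ≤ t n) :
    s ∈ prefixLeast S (n + 1) := by
  refine ⟨hs.1, fun t ht e he h => ?_⟩
  obtain he | rfl := Nat.lt_succ_iff_lt_or_eq.mp he
  · exact hs.2 t ht e he h
  · refine hmin t ⟨ht, fun u hu d hd hud => ?_⟩
    rw [h d hd]
    exact hs.2 u hu d hd fun i hi => (hud i hi).trans (h i (hi.trans hd))

theorem prefixLeast_nonempty {S : Set (ℕ → ℕ)} (hne : S.Nonempty) (n : ℕ) :
    (prefixLeast S n).Nonempty := by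
  induction n with
  | zero =>
    obtain ⟨s, hs⟩ := hne
    exact ⟨s, hs, fun _ _ _ he => absurd he (Nat.not_lt_zero _)⟩
  | succ n ih =>
    refine ⟨Function.argminOn (fun s : ℕ → ℕ => s n) (prefixLeast S n) ih,
      mem_prefixLeast_succ (Function.argminOn_mem _ _ ih) fun t ht => ?_⟩
    exact Function.argminOn_le (fun s : ℕ → ℕ => s n) (prefixLeast S n) ht

theorem lexLE_of_forall_mem_prefixLeast {S : Set (ℕ → ℕ)} {s t : ℕ → ℕ}
    (hs : ∀ n, s ∈ prefixLeast S n) (ht : t ∈ S) : lexLE s t := by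
  classical
  by_cases h : s = t
  · exact Or.inl h
  · have hex : ∃ e, s e ≠ t e := Function.ne_iff.mp h
    have hagree : ∀ i < Nat.find hex, s i = t i := fun i hi => not_not.mp (Nat.find_min hex hi)
    have hle := (hs (Nat.find hex + 1)).2 t ht _ (Nat.lt_succ_self _)
      fun i hi => (hagree i hi).symm
    exact Or.inr ⟨Nat.find hex, lt_of_le_of_ne hle (Nat.find_spec hex), hagree⟩

/-- Core of Corollary 1.2.1.3: every nonempty set of antitone (non-increasing)
sequences `ℕ → ℕ` has a least element for the lexicographic order. -/
theorem exists_lex_least_of_antitone (S : Set (ℕ → ℕ))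
    (hS : ∀ s ∈ S, Antitone s) (hne : S.Nonempty) :
    ∃ s₀ ∈ S, ∀ s ∈ S, lexLE s₀ s := by
  classical
  have hex : ∃ v N, ∃ s ∈ prefixLeast S (N + 1), s N = v := by
    obtain ⟨s, hs⟩ := prefixLeast_nonempty hne 1
    exact ⟨_, 0, s, hs, rfl⟩
  obtain ⟨N, s, hs, hsN⟩ := Nat.find_spec hex
  have hall : ∀ n, s ∈ prefixLeast S n := by
    intro n
    induction n with
    | zero => exact prefixLeast_antitone S (Nat.zero_le _) hs
    | succ n ih =>
      obtain hn | hn := le_total n N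
      · exact prefixLeast_antitone S (Nat.succ_le_succ hn) hs
      · refine mem_prefixLeast_succ ih fun t ht => ?_
        obtain ⟨u, hu⟩ := prefixLeast_nonempty hne (n + 1)
        have hut := eq_of_mem_prefixLeast (prefixLeast_antitone S n.le_succ hu) ht
        calc s n ≤ s N := hS s hs.1 hn
          _ = Nat.find hex := hsN
          _ ≤ u n := Nat.find_min' hex ⟨n, u, hu, rfl⟩
          _ ≤ t n := hu.2 t ht.1 n n.lt_succ_self fun i hi => (hut i hi).symm
  exact ⟨s, hs.1, fun t ht => lexLE_of_forall_mem_prefixLeast hall ht⟩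
end

section
/- Let X be a noetherian topological space, T a linearly ordered set in which every nonempty subset has a least element, and f : X → T an upper semi-continuous function (i.e., {x ∈ X : f(x) ≥ t} is closed for every t ∈ T). Then f takes only finitely many values over X: the range {f(x) : x ∈ X} is a finite subset of T. (Corollary 1.2.1.4.) -/
/-- Corollary 1.2.1.4: an upper semi-continuous function from a noetherian topological
space to a well-ordered linearly ordered set takes only finitely many values. -/
theorem finite_range_of_usc_of_noetherian
    {X T : Type*} [TopologicalSpace X] [TopologicalSpace.NoetherianSpace X] [LinearOrder T]
    (hwo : ∀ S : Set T, S.Nonempty → ∃ m ∈ S, ∀ s ∈ S, m ≤ s)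
    (f : X → T) (husc : ∀ t : T, IsClosed {x : X | t ≤ f x}) :
    (Set.range f).Finite := by
  have : WellFoundedLT T := ⟨WellFounded.wellFounded_iff_has_min.mpr fun S hS =>
    let ⟨m, hm, h⟩ := hwo S hS
    ⟨m, hm, fun s hs => not_lt.mpr (h s hs)⟩⟩
  let F : Set.range f → TopologicalSpace.Closeds X := fun t => ⟨{x | t.1 ≤ f x}, husc t⟩
  have hF : StrictAnti F := by
    rintro ⟨_, x, rfl⟩ ⟨_, y, rfl⟩ (hxy : f x < f y)
    refine lt_of_le_not_ge (fun z (hz : f y ≤ f z) => hxy.le.trans hz) fun h => ?_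
    have hx : f y ≤ f x := h (show f x ≤ f x from le_rfl)
    exact hx.not_gt hxy
  have : WellFoundedGT (Set.range f) := hF.wellFoundedGT
  exact Set.finite_coe_iff.mp (Finite.of_wellFoundedLT_wellFoundedGT _)
end
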